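/- For any contraction g ⇝ g' of finite-dimensional real Lie algebras on the same underlying space V with g not isomorphic to g', there exists a plateau deformation from g' to g inverse to the contraction; that is, there exists a family of Lie brackets μ_t on V, t ∈ [0,1], with t ↦ μ_t(X,Y) continuous for all X,Y ∈ V, such that μ_0 = μ' and (V,μ_t) is isomorphic to (V,μ) as a Lie algebra for all t ∈ (0,1]. -/

import Mathlib

open Filter Topology Set

/-- A Lie bracket on a real vector space `V`: a bilinear alternating map satisfying
the Jacobi identity. -/
structure LieBracketOn (V : Type) [AddCommGroup V] [Module ℝ V] : Type where
  br : V →ₗ[ℝ] V →ₗ[ℝ] V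
  alt : ∀ x : V, br x x = 0
  jacobi : ∀ x y z : V, br x (br y z) + br y (br z x) + br z (br x y) = 0

variable {V : Type} [NormedAddCommGroup V] [NormedSpace ℝ V]

/-- `g = (V,μ)` contracts onto `g' = (V,μ')`: there is a family `Φ_t` of linear
automorphisms of `V` such that `Φ_t⁻¹ (μ (Φ_t X) (Φ_t Y)) → μ' X Y` as `t → ∞`. -/
def Contracts (μ μ' : LieBracketOn V) : Prop :=
  ∃ Φ : ℝ → (V ≃ₗ[ℝ] V), ∀ X Y : V,
    Tendsto (fun t : ℝ => (Φ t).symm (μ.br (Φ t X) (Φ t Y))) atTop (𝓝 (μ'.br X Y))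

/-- `(V,μ)` and `(V,μ')` are isomorphic as Lie algebras. -/
def BrIso (μ μ' : LieBracketOn V) : Prop :=
  ∃ e : V ≃ₗ[ℝ] V, ∀ x y : V, e (μ.br x y) = μ'.br (e x) (e y)

/-- `μt` is a deformation of plateau type from `g' = (V,μ')` to `g = (V,μ)`:
`t ↦ μ_t(X,Y)` is continuous on `[0,1]`, `μ_0 = μ'`, `(V,μ_t) ≃ (V,μ)` for all
`t ∈ (0,1]`, and `(V,μ') ≄ (V,μ)`. -/
def IsPlateauDeformation (μ' μ : LieBracketOn V) (μt : ℝ → LieBracketOn V) : Prop :=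
  (∀ X Y : V, ContinuousOn (fun t => (μt t).br X Y) (Icc (0:ℝ) 1)) ∧
  μt 0 = μ' ∧ (∀ t ∈ Ioc (0:ℝ) 1, BrIso (μt t) μ) ∧ ¬ BrIso μ' μ

open Polynomial in
/-- Up to a nonzero factor of the base ring, every polynomial over a fraction field has coefficients
in the base ring. -/
lemma exists_map_eq_C_mul {A K : Type*} [CommRing A] [IsDomain A] [Field K] [Algebra A K]
    [IsFractionRing A K] (F : K[X]) :
    ∃ b : A, b ≠ 0 ∧ ∃ G : A[X], G.map (algebraMap A K) = C (algebraMap A K b) * F := by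
  obtain ⟨b, hb, hF⟩ := IsLocalization.integerNormalization_spec (nonZeroDivisors A) F
  refine ⟨b, nonZeroDivisors.ne_zero hb, _, hF.trans ?_⟩
  rw [algebra_compatible_smul K b F, smul_eq_C_mul]

open Polynomial in
/-- Over a domain of characteristic zero, every nonzero polynomial has, away from the zeros of some
nonzero constant, the same zeros as a polynomial without multiple roots. -/
lemma exists_squarefree_part {A : Type*} [CommRing A] [IsDomain A] [CharZero A] (P : A[X])
    (hP : P ≠ 0) :
    ∃ (Q : A[X]) (c : A) (m : ℕ), Q ≠ 0 ∧ c ≠ 0 ∧ Q ∣ C c * P ∧ P ∣ C c * Q ^ m ∧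
      ∃ U W : A[X], U * Q + W * derivative Q = C c := by
  classical
  let K := FractionRing A
  let φ := algebraMap A K
  have hφ : Function.Injective φ := IsFractionRing.injective A K
  have hinj : Function.Injective (mapRingHom φ) := map_injective φ hφ
  have hPK : P.map φ ≠ 0 := (Polynomial.map_ne_zero_iff hφ).2 hP
  have : CharZero K := charZero_of_injective_algebraMap hφ
  let R := UniqueFactorizationMonoid.radical (P.map φ)
  obtain ⟨b, hb, Q, hQ⟩ := exists_map_eq_C_mul (A := A) R
  have hφb : φ b ≠ 0 := (map_ne_zero_iff φ hφ).2 hb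
  have hassoc : Associated (Q.map φ) R := by
    rw [hQ]
    exact associated_unit_mul_left _ _ (isUnit_C.2 (isUnit_iff_ne_zero.2 hφb))
  have hR0 : R ≠ 0 := UniqueFactorizationMonoid.radical_ne_zero
  have hQ0 : Q ≠ 0 := by
    rintro rfl
    simp only [Polynomial.map_zero] at hassoc
    exact hR0 (hassoc.symm.eq_zero_iff.2 rfl)
  have hsep : (Q.map φ).Separable := by
    rw [PerfectField.separable_iff_squarefree]
    exact hassoc.symm.squarefree_iff.1 UniqueFactorizationMonoid.squarefree_radical
  obtain ⟨m, hm⟩ := UniqueFactorizationMonoid.exists_dvd_radical_self_pow hPK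
  obtain ⟨S, hS⟩ : Q.map φ ∣ P.map φ :=
    hassoc.dvd.trans UniqueFactorizationMonoid.radical_dvd_self
  obtain ⟨T, hT⟩ : P.map φ ∣ (Q.map φ) ^ m := hm.trans (hassoc.pow_pow.symm.dvd)
  obtain ⟨U, W, hUW⟩ := hsep
  obtain ⟨s, hs, S', hS'⟩ := exists_map_eq_C_mul (A := A) S
  obtain ⟨t, ht, T', hT'⟩ := exists_map_eq_C_mul (A := A) T
  obtain ⟨u, hu, U', hU'⟩ := exists_map_eq_C_mul (A := A) U
  obtain ⟨w, hw, W', hW'⟩ := exists_map_eq_C_mul (A := A) W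
  change S'.map φ = C (φ s) * S at hS'
  change T'.map φ = C (φ t) * T at hT'
  change U'.map φ = C (φ u) * U at hU'
  change W'.map φ = C (φ w) * W at hW'
  refine ⟨Q, s * t * u * w, m, hQ0, by positivity, ⟨C (t * u * w) * S', hinj ?_⟩,
    ⟨C (s * u * w) * T', hinj ?_⟩, C (s * t * w) * U', C (s * t * u) * W', hinj ?_⟩
  · simp only [coe_mapRingHom, map_C, hS', hS, map_mul]
    ring
  · simp only [coe_mapRingHom, map_C, hT', hT, map_mul, Polynomial.map_pow]
    ring
  · simp only [coe_mapRingHom, Polynomial.map_mul, Polynomial.map_add, map_C, hU', hW', map_mul,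
      ← derivative_map]
    linear_combination (C (φ s) * C (φ t) * C (φ u) * C (φ w)) * hUW

/-- The value at `y` of the specialization at `x` of a polynomial with polynomial coefficients. -/
noncomputable def fiberEval {n : ℕ} (Q : Polynomial (MvPolynomial (Fin n) ℝ)) (x : Fin n → ℝ)
    (y : ℝ) : ℝ :=
  (Q.map (MvPolynomial.eval x)).eval y

lemma fiberEval_finSuccEquiv {n : ℕ} (P : MvPolynomial (Fin (n + 1)) ℝ) (x : Fin n → ℝ) (y : ℝ) :
    fiberEval (MvPolynomial.finSuccEquiv ℝ n P) x y = MvPolynomial.eval (Fin.cons y x) P :=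
  (MvPolynomial.eval_eq_eval_mv_eval' x y P).symm

lemma continuous_fiberEval {n : ℕ} (Q : Polynomial (MvPolynomial (Fin n) ℝ)) :
    Continuous fun z : (Fin n → ℝ) × ℝ => fiberEval Q z.1 z.2 := by
  obtain ⟨P, rfl⟩ := (MvPolynomial.finSuccEquiv ℝ n).surjective Q
  simp only [fiberEval_finSuccEquiv]
  exact (MvPolynomial.continuous_eval P).comp (Continuous.finCons continuous_snd continuous_fst)

lemma eventually_fiberEval_ne_zero {n : ℕ} {Q : Polynomial (MvPolynomial (Fin n) ℝ)}
    {x : Fin n → ℝ} {y : ℝ} (h : fiberEval Q x y ≠ 0) :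
    ∀ᶠ z : (Fin n → ℝ) × ℝ in 𝓝 (x, y), fiberEval Q z.1 z.2 ≠ 0 :=
  (continuous_fiberEval Q).continuousAt.eventually_ne h

lemma eventually_fiberEval_left_ne_zero {n : ℕ} {Q : Polynomial (MvPolynomial (Fin n) ℝ)}
    {x : Fin n → ℝ} {y : ℝ} (h : fiberEval Q x y ≠ 0) :
    ∀ᶠ x' in 𝓝 x, fiberEval Q x' y ≠ 0 :=
  ((continuous_fiberEval Q).comp (Continuous.prodMk_left y)).continuousAt.eventually_ne h

lemma hasDerivAt_fiberEval {n : ℕ} (Q : Polynomial (MvPolynomial (Fin n) ℝ)) (x : Fin n → ℝ)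
    (y : ℝ) :
    HasDerivAt (fiberEval Q x) (fiberEval (Polynomial.derivative Q) x y) y := by
  have h := (Q.map (MvPolynomial.eval x)).hasDerivAt y
  rw [Polynomial.derivative_map] at h
  exact h

lemma exists_derivative_eq_zero_of_fiberEval_eq_zero {n : ℕ}
    {Q : Polynomial (MvPolynomial (Fin n) ℝ)} {x : Fin n → ℝ} {a b : ℝ} (hab : a < b)
    (ha : fiberEval Q x a = 0) (hb : fiberEval Q x b = 0) :
    ∃ y ∈ Ioo a b, fiberEval (Polynomial.derivative Q) x y = 0 :=
  exists_hasDerivAt_eq_zero hab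
    (fun y _ => (hasDerivAt_fiberEval Q x y).continuousAt.continuousWithinAt) (ha.trans hb.symm)
    fun y _ => hasDerivAt_fiberEval Q x y

/-- Where the leading coefficient does not vanish, the roots are locally uniformly bounded. -/
lemma exists_bound_of_leadingCoeff_ne_zero {n : ℕ} (Q : Polynomial (MvPolynomial (Fin n) ℝ))
    (x₀ : Fin n → ℝ) (h : MvPolynomial.eval x₀ Q.leadingCoeff ≠ 0) :
    ∃ M : ℝ, ∀ᶠ x in 𝓝 x₀, ∀ y, M < |y| → fiberEval Q x y ≠ 0 := by
  have h0 : fiberEval Q.reverse x₀ 0 ≠ 0 := by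
    rwa [fiberEval, ← Polynomial.coeff_zero_eq_eval_zero, Polynomial.coeff_map,
      Polynomial.coeff_zero_reverse]
  have h1 := eventually_fiberEval_ne_zero h0
  rw [nhds_prod_eq] at h1
  obtain ⟨p, hp, r, hr, hpr⟩ := eventually_prod_iff.1 h1
  obtain ⟨ε, hε, hball⟩ := Metric.eventually_nhds_iff.1 hr
  refine ⟨ε⁻¹, hp.mono fun x hx y hy => ?_⟩
  have hy0 : y ≠ 0 := by
    rintro rfl
    rw [abs_zero] at hy
    exact absurd hy (inv_pos.2 hε).le.not_gt
  have : Invertible y := invertibleOfNonzero hy0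
  have h2 := hpr hx (hball (y := ⅟y) (by
    rw [Real.dist_eq, sub_zero, invOf_eq_inv, abs_inv]
    exact inv_lt_of_inv_lt₀ hε hy))
  have h3 := Polynomial.eval₂_reverse_mul_pow (MvPolynomial.eval x) y Q
  rw [fiberEval, Polynomial.eval_map] at h2 ⊢
  rw [← h3]
  exact mul_ne_zero h2 (pow_ne_zero _ hy0)

/-- Around a simple root there is an interval on which, locally uniformly, the derivative does not
vanish and whose endpoints are not roots. -/
lemma exists_interval_of_simple_root {n : ℕ} {Q : Polynomial (MvPolynomial (Fin n) ℝ)}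
    {x₀ : Fin n → ℝ} {r : ℝ} (hr : fiberEval Q x₀ r = 0)
    (hr' : fiberEval (Polynomial.derivative Q) x₀ r ≠ 0) :
    ∃ δ > 0, ∀ᶠ x in 𝓝 x₀,
      (∀ y ∈ Icc (r - δ) (r + δ), fiberEval (Polynomial.derivative Q) x y ≠ 0) ∧
      fiberEval Q x (r - δ) ≠ 0 ∧ fiberEval Q x (r + δ) ≠ 0 := by
  have h1 := eventually_fiberEval_ne_zero hr'
  rw [nhds_prod_eq] at h1
  obtain ⟨p, hp, s, hs, hps⟩ := eventually_prod_iff.1 h1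
  obtain ⟨δ, hδ, hball⟩ := Metric.nhds_basis_closedBall.eventually_iff.1 hs
  rw [Real.closedBall_eq_Icc] at hball
  have hl : fiberEval Q x₀ (r - δ) ≠ 0 := fun h => by
    obtain ⟨y, hy, hy0⟩ := exists_derivative_eq_zero_of_fiberEval_eq_zero (by linarith) h hr
    exact hps hp.self_of_nhds (hball ⟨hy.1.le, by linarith [hy.2]⟩) hy0
  have hu : fiberEval Q x₀ (r + δ) ≠ 0 := fun h => by
    obtain ⟨y, hy, hy0⟩ := exists_derivative_eq_zero_of_fiberEval_eq_zero (by linarith) hr h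
    exact hps hp.self_of_nhds (hball ⟨by linarith [hy.1], hy.2.le⟩) hy0
  refine ⟨δ, hδ, ?_⟩
  filter_upwards [hp, eventually_fiberEval_left_ne_zero hl, eventually_fiberEval_left_ne_zero hu]
    with x hx hxl hxu
  exact ⟨fun y hy => hps hx (hball hy), hxl, hxu⟩

/-- On an interval without critical points one can move from a non-root to one of the endpoints
without meeting a root. -/
lemma fiberEval_ne_zero_left_or_right {n : ℕ} {Q : Polynomial (MvPolynomial (Fin n) ℝ)}
    {x : Fin n → ℝ} {a b y : ℝ} (hy : y ∈ Icc a b) (hQ : fiberEval Q x y ≠ 0)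
    (hd : ∀ s ∈ Icc a b, fiberEval (Polynomial.derivative Q) x s ≠ 0) :
    (∀ s ∈ Icc a y, fiberEval Q x s ≠ 0) ∨ ∀ s ∈ Icc y b, fiberEval Q x s ≠ 0 := by
  by_contra! h
  obtain ⟨⟨s, hs, hs0⟩, t, ht, ht0⟩ := h
  have hsy : s ≠ y := by
    rintro rfl
    exact hQ hs0
  obtain ⟨u, hu, hu0⟩ := exists_derivative_eq_zero_of_fiberEval_eq_zero
    ((lt_of_le_of_ne hs.2 hsy).trans_le ht.1) hs0 ht0
  exact hd u ⟨hs.1.trans hu.1.le, hu.2.le.trans ht.2⟩ hu0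

/-- Near a point over which `Q` keeps its degree and has only simple roots, points off the zero set
of `Q` can be moved to any neighbouring fibre. -/
lemma exists_nhds_joinedIn_fiberEval_ne_zero {n : ℕ} {Q : Polynomial (MvPolynomial (Fin n) ℝ)}
    {x₀ : Fin n → ℝ} (hlc : MvPolynomial.eval x₀ Q.leadingCoeff ≠ 0)
    (hsimple : ∀ y, fiberEval Q x₀ y = 0 → fiberEval (Polynomial.derivative Q) x₀ y ≠ 0)
    {s : Set (Fin n → ℝ)} (hs : s ∈ 𝓝 x₀) :
    ∃ N ∈ 𝓝 x₀, ∀ x₁ ∈ N, ∀ x₂ ∈ N, ∀ y, fiberEval Q x₁ y ≠ 0 →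
      ∃ y', JoinedIn {z | z.1 ∈ s ∧ fiberEval Q z.1 z.2 ≠ 0} (x₁, y) (x₂, y') := by
  have hQ0 : Q.map (MvPolynomial.eval x₀) ≠ 0 := fun h => hlc <| by
    rw [Polynomial.leadingCoeff, ← Polynomial.coeff_map, h, Polynomial.coeff_zero]
  have hfin : {y | fiberEval Q x₀ y = 0}.Finite :=
    Polynomial.finite_setOfPred_isRoot hQ0
  have hroot : ∀ r : ℝ, ∃ δ > 0, fiberEval Q x₀ r = 0 → ∀ᶠ x in 𝓝 x₀,
      (∀ y ∈ Icc (r - δ) (r + δ), fiberEval (Polynomial.derivative Q) x y ≠ 0) ∧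
      fiberEval Q x (r - δ) ≠ 0 ∧ fiberEval Q x (r + δ) ≠ 0 := fun r => by
    by_cases hr : fiberEval Q x₀ r = 0
    · obtain ⟨δ, hδ, h⟩ := exists_interval_of_simple_root hr (hsimple r hr)
      exact ⟨δ, hδ, fun _ => h⟩
    · exact ⟨1, one_pos, fun h => absurd h hr⟩
  choose δ hδ hroot using hroot
  obtain ⟨M, hM⟩ := exists_bound_of_leadingCoeff_ne_zero Q x₀ hlc
  have hroots := (hfin.eventually_all (l := 𝓝 x₀)).2 hroot
  let K : Set ℝ := Icc (-M) M \ ⋃ r ∈ {y | fiberEval Q x₀ y = 0}, Ioo (r - δ r) (r + δ r)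
  have hK : IsCompact K := isCompact_Icc.diff (isOpen_biUnion fun _ _ => isOpen_Ioo)
  have hKne : ∀ᶠ x in 𝓝 x₀, ∀ y ∈ K, fiberEval Q x y ≠ 0 := by
    refine hK.eventually_forall_of_forall_eventually fun y hy =>
      eventually_fiberEval_ne_zero fun h0 => hy.2 ?_
    exact mem_biUnion (show y ∈ {y | fiberEval Q x₀ y = 0} from h0)
      ⟨by linarith [hδ y], by linarith [hδ y]⟩
  obtain ⟨ε, hε, hball⟩ := Metric.eventually_nhds_iff_ball.1
    ((hM.and hroots).and (hKne.and hs))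
  let N := Metric.ball x₀ ε
  have hvert : ∀ x₁ ∈ N, ∀ y, fiberEval Q x₁ y ≠ 0 → ∃ y', (∀ x ∈ N, fiberEval Q x y' ≠ 0) ∧
      ∀ t ∈ uIcc y y', fiberEval Q x₁ t ≠ 0 := by
    intro x₁ hx₁ y hy
    have hself : ∀ t ∈ uIcc y y, fiberEval Q x₁ t ≠ 0 := by
      rw [uIcc_self]
      rintro t rfl
      exact hy
    by_cases hyM : M < |y|
    · exact ⟨y, fun x hx => (hball x hx).1.1 y hyM, hself⟩
    by_cases hyr : y ∈ ⋃ r ∈ {y | fiberEval Q x₀ y = 0}, Ioo (r - δ r) (r + δ r)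
    · obtain ⟨r, hr, hry⟩ := mem_iUnion₂.1 hyr
      rcases fiberEval_ne_zero_left_or_right (Ioo_subset_Icc_self hry) hy
        ((hball x₁ hx₁).1.2 r hr).1 with h | h
      · exact ⟨r - δ r, fun x hx => ((hball x hx).1.2 r hr).2.1, by rwa [uIcc_of_ge hry.1.le]⟩
      · exact ⟨r + δ r, fun x hx => ((hball x hx).1.2 r hr).2.2, by rwa [uIcc_of_le hry.2.le]⟩
    · exact ⟨y, fun x hx => (hball x hx).2.1 y ⟨abs_le.1 (not_lt.1 hyM), hyr⟩, hself⟩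
  refine ⟨N, Metric.ball_mem_nhds x₀ hε, fun x₁ hx₁ x₂ hx₂ y hy => ?_⟩
  obtain ⟨y', hy', hseg⟩ := hvert x₁ hx₁ y hy
  refine ⟨y', JoinedIn.trans (y := (x₁, y')) ?_ ?_⟩
  · refine ((((convex_uIcc y y').isPathConnected nonempty_uIcc).joinedIn y left_mem_uIcc y'
      right_mem_uIcc).map (Continuous.prodMk_right x₁)).mono ?_
    rintro _ ⟨t, ht, rfl⟩
    exact ⟨(hball x₁ hx₁).2.2, hseg t ht⟩
  · refine ((((convex_ball x₀ ε).isPathConnected ⟨x₁, hx₁⟩).joinedIn x₁ hx₁ x₂ hx₂).map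
      (Continuous.prodMk_left y')).mono ?_
    rintro _ ⟨x, hx, rfl⟩
    exact ⟨(hball x hx).2.2, hy' x hx⟩

/-- If every point of a path in `s` has a neighbourhood over which points of `W` can be moved along
fibres, then points of `W` can be transported along the path. -/
lemma exists_joinedIn_lift {X Y : Type*} [TopologicalSpace X] [TopologicalSpace Y]
    {s : Set X} {W : Set (X × Y)}
    (hloc : ∀ x₀ ∈ s, ∃ N ∈ 𝓝 x₀, ∀ x₁ ∈ N, ∀ x₂ ∈ N, ∀ y, (x₁, y) ∈ W →
      ∃ y', JoinedIn W (x₁, y) (x₂, y'))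
    {a b : X} (hab : JoinedIn s a b) {y : Y} (hy : (a, y) ∈ W) :
    ∃ y', JoinedIn W (a, y) (b, y') := by
  obtain ⟨γ, hγ⟩ := hab
  let f : unitInterval → Prop := fun t => ∃ y', JoinedIn W (a, y) (γ t, y')
  have hf : IsLocallyConstant f := by
    rw [IsLocallyConstant.iff_eventually_eq]
    intro t
    obtain ⟨N, hN, h⟩ := hloc (γ t) (hγ t)
    filter_upwards [γ.continuous.continuousAt hN] with u hu
    have hstep : ∀ x₁ ∈ N, ∀ x₂ ∈ N, (∃ y', JoinedIn W (a, y) (x₁, y')) →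
        ∃ y', JoinedIn W (a, y) (x₂, y') := fun x₁ hx₁ x₂ hx₂ ⟨y', hy'⟩ =>
      let ⟨y'', hy''⟩ := h x₁ hx₁ x₂ hx₂ y' hy'.target_mem
      ⟨y'', hy'.trans hy''⟩
    exact propext ⟨hstep _ hu _ (mem_of_mem_nhds hN), hstep _ (mem_of_mem_nhds hN) _ hu⟩
  have h01 : f 0 = f 1 := hf.apply_eq_of_preconnectedSpace 0 1
  have h0 : f 0 := ⟨y, by simpa using JoinedIn.refl hy⟩
  rw [h01] at h0
  simpa [f] using h0

/-- The complement of a finite set of reals has finitely many path components. -/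
lemma exists_finite_joinedIn_compl {Z : Set ℝ} (hZ : Z.Finite) :
    ∃ F : Set ℝ, F.Finite ∧ ∀ y ∉ Z, ∃ z ∈ F, JoinedIn Zᶜ y z := by
  classical
  let below : ↥Zᶜ → Set ℝ := fun y => Z ∩ Iio y
  have hfin : (range below).Finite :=
    hZ.finite_subsets.subset (range_subset_iff.2 fun y => inter_subset_left)
  choose g hg using fun c : range below => c.2
  refine ⟨range fun c => (g c : ℝ), ?_,
    fun y hy => ⟨_, mem_range_self ⟨_, mem_range_self ⟨y, hy⟩⟩, ?_⟩⟩
  · have := hfin.to_subtype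
    exact finite_range _
  · set z := g ⟨_, mem_range_self ⟨y, hy⟩⟩
    have hz : below z = below ⟨y, hy⟩ := hg _
    refine (((convex_uIcc y z).isPathConnected nonempty_uIcc).joinedIn y left_mem_uIcc z
      right_mem_uIcc).mono fun t ht htZ => ?_
    have h1 : t ∈ below z ↔ t ∈ below ⟨y, hy⟩ := by rw [hz]
    simp only [below, mem_inter_iff, htZ, true_and, mem_Iio] at h1
    have hty : t ≠ y := fun h => hy (h ▸ htZ)
    have htz : t ≠ z := fun h => z.2 (h ▸ htZ)
    rcases mem_uIcc.1 ht with h | h <;> grind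

/-- A nonzero real polynomial does not vanish identically on a nonempty open set. -/
lemma MvPolynomial.exists_mem_eval_ne_zero {n : ℕ} {p : MvPolynomial (Fin n) ℝ} (hp : p ≠ 0)
    {x : Fin n → ℝ} {s : Set (Fin n → ℝ)} (hs : s ∈ 𝓝 x) : ∃ z ∈ s, eval z p ≠ 0 := by
  by_contra! h
  obtain ⟨ε, hε, hball⟩ := Metric.mem_nhds_iff.1 hs
  refine hp (funext_set (fun i => Metric.ball (x i) ε) (fun i => ?_) fun z hz => ?_)
  · rw [Real.ball_eq_Ioo]
    exact Ioo_infinite (by linarith)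
  · rw [h z (hball (by rwa [ball_pi x hε])), map_zero]

/-- The complement of the zero set of a nonzero real polynomial has finitely many path
components. -/
lemma MvPolynomial.exists_finite_joinedIn_eval_ne_zero {n : ℕ} (P : MvPolynomial (Fin n) ℝ)
    (hP : P ≠ 0) :
    ∃ F : Set (Fin n → ℝ), F.Finite ∧
      ∀ x, eval x P ≠ 0 → ∃ z ∈ F, JoinedIn {x | eval x P ≠ 0} x z := by
  induction n with
  | zero => exact ⟨univ, finite_univ, fun x hx => ⟨x, mem_univ x, JoinedIn.refl hx⟩⟩
  | succ n ih =>
    obtain ⟨Q, c, m, hQ, hc, ⟨S, hS⟩, ⟨T, hT⟩, U, W, hUW⟩ :=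
      exists_squarefree_part (finSuccEquiv ℝ n P)
        ((map_ne_zero_iff _ (finSuccEquiv ℝ n).injective).2 hP)
    let D := c * Q.leadingCoeff
    have hD : D ≠ 0 := mul_ne_zero hc (Polynomial.leadingCoeff_ne_zero.2 hQ)
    have hDc : ∀ {x}, eval x D ≠ 0 → eval x c ≠ 0 ∧ eval x Q.leadingCoeff ≠ 0 := fun h =>
      mul_ne_zero_iff.1 (by rwa [map_mul] at h)
    have hPQ : ∀ x y, eval x D ≠ 0 → (eval (Fin.cons y x) P ≠ 0 ↔ fiberEval Q x y ≠ 0) := by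
      intro x y hx
      have hcx := (hDc hx).1
      have hS' := congrArg (fun p => fiberEval p x y) hS
      have hT' := congrArg (fun p => fiberEval p x y) hT
      simp only [fiberEval, Polynomial.map_mul, Polynomial.map_pow, Polynomial.map_C,
        Polynomial.eval_mul, Polynomial.eval_pow, Polynomial.eval_C] at hS' hT'
      rw [← eval_eq_eval_mv_eval'] at hS' hT'
      constructor
      · intro h h0
        rw [fiberEval] at h0
        rw [h0, zero_mul] at hS'
        exact mul_ne_zero hcx h hS'
      · intro h h0
        rw [h0, zero_mul] at hT'
        exact mul_ne_zero hcx (pow_ne_zero m h) hT'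
    have hsimple : ∀ x, eval x D ≠ 0 → ∀ y, fiberEval Q x y = 0 →
        fiberEval (Polynomial.derivative Q) x y ≠ 0 := by
      intro x hx y h0 h1
      have h2 := congrArg (fun p => fiberEval p x y) hUW
      simp only [fiberEval, Polynomial.map_mul, Polynomial.map_add, Polynomial.map_C,
        Polynomial.eval_mul, Polynomial.eval_add, Polynomial.eval_C] at h0 h1 h2
      rw [h0, h1, mul_zero, mul_zero, add_zero] at h2
      exact (hDc hx).1 h2.symm
    let Ω : Set ((Fin n → ℝ) × ℝ) := {z | eval z.1 D ≠ 0 ∧ fiberEval Q z.1 z.2 ≠ 0}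
    have hcons : Continuous fun z : (Fin n → ℝ) × ℝ => (Fin.cons z.2 z.1 : Fin (n + 1) → ℝ) :=
      Continuous.finCons continuous_snd continuous_fst
    have hlift : ∀ {z w}, JoinedIn Ω z w →
        JoinedIn {x | eval x P ≠ 0} (Fin.cons z.2 z.1) (Fin.cons w.2 w.1) := fun h =>
      (h.map hcons).mono (by
        rintro _ ⟨z, hz, rfl⟩
        exact (hPQ z.1 z.2 hz.1).2 hz.2)
    have hloc : ∀ x₀ ∈ {x | eval x D ≠ 0}, ∃ N ∈ 𝓝 x₀, ∀ x₁ ∈ N, ∀ x₂ ∈ N, ∀ y, (x₁, y) ∈ Ω →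
        ∃ y', JoinedIn Ω (x₁, y) (x₂, y') := fun x₀ hx₀ => by
      obtain ⟨N, hN, h⟩ := exists_nhds_joinedIn_fiberEval_ne_zero (hDc hx₀).2 (hsimple x₀ hx₀)
        ((continuous_eval D).continuousAt.eventually_ne hx₀)
      exact ⟨N, hN, fun x₁ hx₁ x₂ hx₂ y hy => h x₁ hx₁ x₂ hx₂ y hy.2⟩
    obtain ⟨F, hF, hFD⟩ := ih D hD
    have hfiber : ∀ x, ∃ G : Set ℝ, G.Finite ∧ (eval x D ≠ 0 → ∀ y, fiberEval Q x y ≠ 0 →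
        ∃ z ∈ G, JoinedIn {y | fiberEval Q x y = 0}ᶜ y z) := fun x => by
      by_cases hx : eval x D ≠ 0
      · have hQ0 : Q.map (eval x) ≠ 0 := fun h => (hDc hx).2 <| by
          rw [Polynomial.leadingCoeff, ← Polynomial.coeff_map, h, Polynomial.coeff_zero]
        obtain ⟨G, hG, h⟩ := exists_finite_joinedIn_compl
          (Z := {y | fiberEval Q x y = 0}) (Polynomial.finite_setOfPred_isRoot hQ0)
        exact ⟨G, hG, fun _ => h⟩
      · exact ⟨∅, finite_empty, fun h => absurd h hx⟩
    choose G hG hGJ using hfiber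
    refine ⟨⋃ x ∈ F, (fun y => Fin.cons y x) '' G x, hF.biUnion fun x _ => (hG x).image _,
      fun x hx => ?_⟩
    obtain ⟨ε, hε, hball⟩ := Metric.eventually_nhds_iff_ball.1
      ((continuous_eval P).continuousAt.eventually_ne hx)
    obtain ⟨x', hx', hDx'⟩ := exists_mem_eval_ne_zero (p := rename Fin.succ D)
      ((map_ne_zero_iff _ (rename_injective _ (Fin.succ_injective n))).2 hD)
      (Metric.ball_mem_nhds x hε)
    have hxx' : JoinedIn {x | eval x P ≠ 0} x x' :=
      (((convex_ball x ε).isPathConnected ⟨x', hx'⟩).joinedIn x (Metric.mem_ball_self hε) x'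
        hx').mono hball
    obtain ⟨y, a, rfl⟩ : ∃ (y : ℝ) (a : Fin n → ℝ), x' = Fin.cons y a :=
      ⟨x' 0, Fin.tail x', (Fin.cons_self_tail x').symm⟩
    have ha : eval a D ≠ 0 := by
      rwa [eval_rename, show (Fin.cons y a : Fin (n + 1) → ℝ) ∘ Fin.succ = a from rfl] at hDx'
    obtain ⟨b, hbF, hab⟩ := hFD a ha
    have hay : (a, y) ∈ Ω := ⟨ha, (hPQ a y ha).1 hxx'.target_mem⟩
    obtain ⟨y', hy'⟩ := exists_joinedIn_lift hloc hab hay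
    obtain ⟨y'', hy''G, hy''⟩ := hGJ b hab.target_mem y' hy'.target_mem.2
    refine ⟨Fin.cons y'' b, mem_biUnion hbF (mem_image_of_mem _ hy''G),
      (hxx'.trans (hlift hy')).trans (hlift (z := (b, y')) (w := (b, y'')) ?_)⟩
    refine (hy''.map (Continuous.prodMk_right b)).mono ?_
    rintro _ ⟨t, ht, rfl⟩
    exact ⟨hab.target_mem, ht⟩

/-- On a path along which a continuous function does not vanish, it keeps its sign. -/
lemma JoinedIn.pos_of_ne_zero {X : Type*} [TopologicalSpace X] {f : X → ℝ} (hf : Continuous f)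
    {x y : X} (h : JoinedIn {x | f x ≠ 0} x y) (hx : 0 < f x) : JoinedIn {x | 0 < f x} x y := by
  obtain ⟨γ, hγ⟩ := h
  refine ⟨γ, fun t => ?_⟩
  change 0 < f (γ t)
  refine lt_of_not_ge fun ht => ?_
  obtain ⟨u, hu⟩ := mem_range_of_exists_le_of_exists_ge (c := 0) (hf.comp γ.continuous)
    ⟨t, ht⟩ ⟨0, by simpa using hx.le⟩
  exact hγ u hu

/-- Countably many consecutive paths can be concatenated to a continuous curve on the half-line. -/
lemma exists_continuous_concat {X : Type*} [TopologicalSpace X] {S : ℕ → Set X} {y : ℕ → X}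
    (h : ∀ k, JoinedIn (S k) (y k) (y (k + 1))) :
    ∃ Γ : ℝ → X, Continuous Γ ∧ ∀ s, Γ s ∈ S ⌊s⌋₊ := by
  choose γ hγ using h
  let Γ : ℝ → X := fun s => (γ ⌊s⌋₊).extend (s - ⌊s⌋₊)
  have hfloor : ∀ s k, ⌊s⌋₊ = k → Γ s = (γ k).extend (s - k) := by
    rintro s _ rfl
    rfl
  have hΓ : ∀ k : ℕ, ∀ s ∈ Icc (k : ℝ) (k + 1), Γ s = (γ k).extend (s - k) := by
    intro k s hs
    rcases hs.2.eq_or_lt with rfl | hlt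
    · rw [hfloor _ (k + 1) (by exact_mod_cast Nat.floor_natCast (R := ℝ) (k + 1))]
      simp
    · exact hfloor s k ((Nat.floor_eq_iff (k.cast_nonneg.trans hs.1)).2 ⟨hs.1, hlt⟩)
  have hΓ0 : ∀ s : ℝ, s ≤ 0 → Γ s = y 0 := by
    intro s hs
    rw [hfloor s 0 (Nat.floor_of_nonpos hs), Path.extend_of_le_zero _ (by simpa using hs)]
  have hcont : ∀ k : ℕ, ContinuousOn Γ (Iic (k : ℝ)) := by
    intro k
    induction k with
    | zero => exact continuousOn_const.congr fun s hs => hΓ0 s (by simpa using hs)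
    | succ k ih =>
      have hk : ContinuousOn Γ (Icc (k : ℝ) (k + 1)) :=
        ((γ k).continuous_extend.comp (continuous_sub_right (k : ℝ))).continuousOn.congr (hΓ k)
      have := ih.union_of_isClosed hk isClosed_Iic isClosed_Icc
      rwa [Iic_union_Icc_eq_Iic (by linarith), ← Nat.cast_succ] at this
  refine ⟨Γ, continuous_iff_continuousAt.2 fun s => ?_, fun s => ?_⟩
  · obtain ⟨k, hk⟩ := exists_nat_gt s
    exact (hcont k).continuousAt (Iic_mem_nhds hk)
  · obtain ⟨u, hu⟩ : Γ s ∈ range (γ ⌊s⌋₊) := by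
      rw [← Path.extend_range]
      exact mem_range_self _
    rw [← hu]
    exact hγ _ u

/-- If a sequence eventually enters each member of a decreasing sequence of semialgebraic sets
`{G k > 0}`, then there is a continuous curve with the same property. -/
lemma exists_continuous_curve_of_eventually_pos {n : ℕ} (G : ℕ → MvPolynomial (Fin n) ℝ)
    (hanti : ∀ k x, 0 < MvPolynomial.eval x (G (k + 1)) → 0 < MvPolynomial.eval x (G k))
    (g : ℕ → Fin n → ℝ) (hg : ∀ k, ∀ᶠ m in atTop, 0 < MvPolynomial.eval (g m) (G k)) :
    ∃ Γ : ℝ → Fin n → ℝ, Continuous Γ ∧ ∀ s, 0 < MvPolynomial.eval (Γ s) (G ⌊s⌋₊) := by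
  let S : ℕ → Set (Fin n → ℝ) := fun k => {x | 0 < MvPolynomial.eval x (G k)}
  have hy : ∀ k, ∃ z, ∀ᶠ m in hyperfilter ℕ, JoinedIn (S k) (g m) z := by
    intro k
    have hG : G k ≠ 0 := fun h => by
      obtain ⟨m, hm⟩ := (hg k).exists
      simp [h] at hm
    obtain ⟨F, hF, hFJ⟩ := (G k).exists_finite_joinedIn_eval_ne_zero hG
    obtain ⟨z, -, hz⟩ := (Ultrafilter.eventually_exists_mem_iff (f := hyperfilter ℕ)
      (P := fun z m => JoinedIn (S k) (g m) z) hF).1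
      (((hg k).filter_mono Nat.hyperfilter_le_atTop).mono fun m hm => by
        obtain ⟨z, hz, hJ⟩ := hFJ (g m) hm.ne'
        exact ⟨z, hz, hJ.pos_of_ne_zero (MvPolynomial.continuous_eval (G k)) hm⟩)
    exact ⟨z, hz⟩
  choose y hy using hy
  exact exists_continuous_concat (S := S) (y := y) fun k => by
    obtain ⟨m, h1, h2⟩ := ((hy k).and (hy (k + 1))).exists
    exact h1.symm.trans (h2.mono (hanti k))

/-- The pullback of a bilinear map along the endomorphism given by a matrix. -/
noncomputable def matrixPullback {ι : Type*} [Fintype ι] [DecidableEq ι] (b : Module.Basis ι ℝ V)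
    (β : V →ₗ[ℝ] V →ₗ[ℝ] V) (A : Matrix ι ι ℝ) (X Y : V) : V :=
  Matrix.toLin b b A⁻¹ (β (Matrix.toLin b b A X) (Matrix.toLin b b A Y))

/-- The sum of squares of the differences of the structure constants of a pullback of `β` and
those of `β'`. -/
noncomputable def pullbackDefect {ι : Type*} [Fintype ι] [DecidableEq ι] (b : Module.Basis ι ℝ V)
    (β β' : V →ₗ[ℝ] V →ₗ[ℝ] V) (A : Matrix ι ι ℝ) : ℝ :=
  ∑ i, ∑ j, ∑ k, (b.repr (matrixPullback b β A (b i) (b j)) k - b.repr (β' (b i) (b j)) k) ^ 2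

/-- The square matrix with the given list of entries. -/
def matrixOfEntries {d : ℕ} {R : Type*} (x : Fin (d * d) → R) : Matrix (Fin d) (Fin d) R :=
  Matrix.of fun i j => x (finProdFinEquiv (i, j))

lemma det_mul_repr_matrixPullback {ι : Type*} [Fintype ι] [DecidableEq ι]
    (b : Module.Basis ι ℝ V) (β : V →ₗ[ℝ] V →ₗ[ℝ] V) {A : Matrix ι ι ℝ} (hA : A.det ≠ 0)
    (i j k : ι) :
    A.det * b.repr (matrixPullback b β A (b i) (b j)) k =
      ∑ l, A.adjugate k l * ∑ p, ∑ q, A p i * A q j * b.repr (β (b p) (b q)) l := by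
  have h1 : ∀ l, b.repr (β (Matrix.toLin b b A (b i)) (Matrix.toLin b b A (b j))) l =
      ∑ p, ∑ q, A p i * A q j * b.repr (β (b p) (b q)) l := fun l => by
    simp only [Matrix.toLin_self, map_sum, map_smul, LinearMap.sum_apply, LinearMap.smul_apply,
      Finsupp.finsetSum_apply, Finsupp.smul_apply, smul_eq_mul, Finset.mul_sum]
    rw [Finset.sum_comm]
    simp only [mul_assoc, mul_left_comm (A _ j)]
  rw [matrixPullback, ← LinearMap.toMatrix_mulVec_repr b b, LinearMap.toMatrix_toLin,
    Matrix.inv_def, Ring.inverse_eq_inv', Matrix.smul_mulVec, Pi.smul_apply, smul_eq_mul,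
    mul_inv_cancel_left₀ hA]
  simp only [Matrix.mulVec, dotProduct, h1]

lemma exists_polynomial_pos_iff_pullbackDefect_lt {d : ℕ} (b : Module.Basis (Fin d) ℝ V)
    (β β' : V →ₗ[ℝ] V →ₗ[ℝ] V) (ε : ℝ) :
    ∃ G : MvPolynomial (Fin (d * d)) ℝ, ∀ x, 0 < MvPolynomial.eval x G ↔
      (matrixOfEntries x).det ≠ 0 ∧ pullbackDefect b β β' (matrixOfEntries x) < ε := by
  let Z : Matrix (Fin d) (Fin d) (MvPolynomial (Fin (d * d)) ℝ) :=
    matrixOfEntries MvPolynomial.X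
  let h : Fin d → Fin d → Fin d → MvPolynomial (Fin (d * d)) ℝ := fun i j k =>
    ∑ l, Z.adjugate k l * ∑ p, ∑ q, Z p i * Z q j * MvPolynomial.C (b.repr (β (b p) (b q)) l) -
      Z.det * MvPolynomial.C (b.repr (β' (b i) (b j)) k)
  refine ⟨MvPolynomial.C ε * Z.det ^ 2 - ∑ i, ∑ j, ∑ k, h i j k ^ 2, fun x => ?_⟩
  set A := matrixOfEntries x
  have hZ : (MvPolynomial.eval x).mapMatrix Z = A := by
    ext i j
    simp [Z, A, matrixOfEntries]
  have hZe : ∀ i j, MvPolynomial.eval x (Z i j) = A i j := fun i j => congrFun₂ hZ i j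
  have hdet : MvPolynomial.eval x Z.det = A.det := by rw [RingHom.map_det, hZ]
  have hadj : ∀ i j, MvPolynomial.eval x (Z.adjugate i j) = A.adjugate i j := fun i j => by
    rw [← hZ, ← RingHom.map_adjugate]
    rfl
  simp only [map_sub, map_mul, map_pow, map_sum, MvPolynomial.eval_C, hdet]
  by_cases hA : A.det = 0
  · simp only [hA, ne_eq, not_true_eq_false, false_and, iff_false, not_lt]
    have : 0 ≤ ∑ i, ∑ j, ∑ k, MvPolynomial.eval x (h i j k) ^ 2 := by positivity
    linarith
  · have hh : ∀ i j k, MvPolynomial.eval x (h i j k) =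
        A.det * (b.repr (matrixPullback b β A (b i) (b j)) k - b.repr (β' (b i) (b j)) k) :=
      fun i j k => by
        rw [mul_sub, det_mul_repr_matrixPullback b β hA]
        simp only [h, map_sub, map_mul, map_sum, MvPolynomial.eval_C, hdet, hadj, hZe]
    have hsum : ∑ i, ∑ j, ∑ k, MvPolynomial.eval x (h i j k) ^ 2 =
        A.det ^ 2 * pullbackDefect b β β' A := by
      simp only [hh, mul_pow, pullbackDefect, Finset.mul_sum]
    have hpos : 0 < A.det ^ 2 := by positivity
    rw [hsum, show ε * A.det ^ 2 - A.det ^ 2 * pullbackDefect b β β' A =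
      A.det ^ 2 * (ε - pullbackDefect b β β' A) by ring, mul_pos_iff_of_pos_left hpos, sub_pos]
    simp [hA]

lemma ContinuousAt.bilinear_apply {T E F H : Type*} [TopologicalSpace T]
    [AddCommGroup E] [Module ℝ E] [TopologicalSpace E]
    [IsTopologicalAddGroup E] [ContinuousSMul ℝ E] [T2Space E] [FiniteDimensional ℝ E]
    [NormedAddCommGroup F] [NormedSpace ℝ F] [FiniteDimensional ℝ F]
    [NormedAddCommGroup H] [NormedSpace ℝ H] (B : E →ₗ[ℝ] F →ₗ[ℝ] H) {f : T → E} {g : T → F}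
    {a : T} (hf : ContinuousAt f a) (hg : ContinuousAt g a) :
    ContinuousAt (fun x => B (f x) (g x)) a :=
  have hB : Continuous fun e => LinearMap.toContinuousLinearMap (B e) :=
    (LinearMap.toContinuousLinearMap.toLinearMap ∘ₗ B).continuous_of_finiteDimensional
  (ContinuousAt.comp (f := f) hB.continuousAt hf).clm_apply hg

lemma ContinuousAt.matrixToLin_apply {T ι : Type*} [TopologicalSpace T] [Fintype ι]
    [DecidableEq ι] [FiniteDimensional ℝ V] (b : Module.Basis ι ℝ V) {f : T → Matrix ι ι ℝ}
    {g : T → V} {a : T} (hf : ContinuousAt f a) (hg : ContinuousAt g a) :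
    ContinuousAt (fun x => Matrix.toLin b b (f x) (g x)) a :=
  hf.bilinear_apply (Matrix.toLin b b).toLinearMap hg

lemma Matrix.continuousAt_inv {ι : Type*} [Fintype ι] [DecidableEq ι] {A : Matrix ι ι ℝ}
    (hA : A.det ≠ 0) : ContinuousAt (fun A : Matrix ι ι ℝ => A⁻¹) A := by
  simp only [Matrix.inv_def, Ring.inverse_eq_inv']
  exact (continuous_id.matrix_det.continuousAt.inv₀ hA).smul
    continuous_id.matrix_adjugate.continuousAt

lemma continuousAt_matrixPullback {ι : Type*} [Fintype ι] [DecidableEq ι] [FiniteDimensional ℝ V]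
    (b : Module.Basis ι ℝ V) (β : V →ₗ[ℝ] V →ₗ[ℝ] V) {A : Matrix ι ι ℝ} (hA : A.det ≠ 0)
    (X Y : V) : ContinuousAt (fun A => matrixPullback b β A X Y) A := by
  have hX : ∀ X : V, ContinuousAt (fun A : Matrix ι ι ℝ => Matrix.toLin b b A X) A := fun X =>
    continuousAt_id.matrixToLin_apply b continuousAt_const
  exact (Matrix.continuousAt_inv hA).matrixToLin_apply b ((hX X).bilinear_apply β (hX Y))

lemma matrixPullback_toMatrix {ι : Type*} [Fintype ι] [DecidableEq ι] (b : Module.Basis ι ℝ V)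
    (β : V →ₗ[ℝ] V →ₗ[ℝ] V) (e : V ≃ₗ[ℝ] V) (X Y : V) :
    matrixPullback b β (LinearMap.toMatrix b b e) X Y = e.symm (β (e X) (e Y)) := by
  have hinv : (LinearMap.toMatrix b b e.toLinearMap)⁻¹ =
      LinearMap.toMatrix b b e.symm.toLinearMap := by
    refine Matrix.inv_eq_left_inv ?_
    rw [← LinearMap.toMatrix_comp]
    simp
  rw [matrixPullback, hinv, Matrix.toLin_toMatrix, Matrix.toLin_toMatrix]
  rfl

lemma tendsto_bilinear_of_basis {ι T : Type*} [Fintype ι] (b : Module.Basis ι ℝ V) {l : Filter T}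
    {B : T → V →ₗ[ℝ] V →ₗ[ℝ] V} {B' : V →ₗ[ℝ] V →ₗ[ℝ] V}
    (h : ∀ i j, Tendsto (fun t => B t (b i) (b j)) l (𝓝 (B' (b i) (b j)))) (X Y : V) :
    Tendsto (fun t => B t X Y) l (𝓝 (B' X Y)) := by
  have hexp : ∀ C : V →ₗ[ℝ] V →ₗ[ℝ] V,
      C X Y = ∑ i, ∑ j, b.repr X i • b.repr Y j • C (b i) (b j) := fun C => by
    conv_lhs => rw [← b.sum_repr X, ← b.sum_repr Y]
    simp only [map_sum, map_smul, LinearMap.sum_apply, LinearMap.smul_apply, Finset.smul_sum]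
    rw [Finset.sum_comm]
    simp only [smul_comm (b.repr Y _)]
  simp only [hexp]
  exact tendsto_finsetSum _ fun i _ => tendsto_finsetSum _ fun j _ =>
    ((h i j).const_smul _).const_smul _

lemma tendsto_matrixPullback_of_pullbackDefect {ι T : Type*} [Fintype ι] [DecidableEq ι]
    (b : Module.Basis ι ℝ V) {β β' : V →ₗ[ℝ] V →ₗ[ℝ] V} {l : Filter T} {A : T → Matrix ι ι ℝ}
    (h : Tendsto (fun t => pullbackDefect b β β' (A t)) l (𝓝 0)) (i j : ι) :
    Tendsto (fun t => matrixPullback b β (A t) (b i) (b j)) l (𝓝 (β' (b i) (b j))) := by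
  have hcoord : ∀ k, Tendsto (fun t => b.repr (matrixPullback b β (A t) (b i) (b j)) k) l
      (𝓝 (b.repr (β' (b i) (b j)) k)) := fun k => by
    rw [tendsto_iff_dist_tendsto_zero]
    have hle : ∀ t, dist (b.repr (matrixPullback b β (A t) (b i) (b j)) k)
        (b.repr (β' (b i) (b j)) k) ≤ √(pullbackDefect b β β' (A t)) := fun t => by
      rw [Real.dist_eq, ← Real.sqrt_sq_eq_abs]
      refine Real.sqrt_le_sqrt ?_
      let f : ι → ι → ι → ℝ := fun i j k =>
        (b.repr (matrixPullback b β (A t) (b i) (b j)) k - b.repr (β' (b i) (b j)) k) ^ 2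
      have hf : ∀ i j k, 0 ≤ f i j k := fun i j k => sq_nonneg _
      calc f i j k ≤ ∑ k, f i j k :=
            Finset.single_le_sum (f := fun k => f i j k) (fun _ _ => hf _ _ _) (Finset.mem_univ k)
        _ ≤ ∑ j, ∑ k, f i j k := Finset.single_le_sum (f := fun j => ∑ k, f i j k)
            (fun _ _ => Finset.sum_nonneg fun _ _ => hf _ _ _) (Finset.mem_univ j)
        _ ≤ ∑ i, ∑ j, ∑ k, f i j k := Finset.single_le_sum (f := fun i => ∑ j, ∑ k, f i j k)
            (fun _ _ => Finset.sum_nonneg fun _ _ => Finset.sum_nonneg fun _ _ => hf _ _ _)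
            (Finset.mem_univ i)
    refine squeeze_zero (fun _ => dist_nonneg) hle ?_
    simpa using h.sqrt
  have hsum := tendsto_finsetSum Finset.univ fun k _ => (hcoord k).smul_const (b k)
  simpa only [b.sum_repr] using hsum

lemma tendsto_pullbackDefect {ι T : Type*} [Fintype ι] [DecidableEq ι] [FiniteDimensional ℝ V]
    (b : Module.Basis ι ℝ V) {β β' : V →ₗ[ℝ] V →ₗ[ℝ] V} {l : Filter T} {A : T → Matrix ι ι ℝ}
    (h : ∀ X Y, Tendsto (fun t => matrixPullback b β (A t) X Y) l (𝓝 (β' X Y))) :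
    Tendsto (fun t => pullbackDefect b β β' (A t)) l (𝓝 0) := by
  have hterm : ∀ i j k, Tendsto (fun t => (b.repr (matrixPullback b β (A t) (b i) (b j)) k -
      b.repr (β' (b i) (b j)) k) ^ 2) l (𝓝 0) := fun i j k => by
    have hc := ((b.coord k).continuous_of_finiteDimensional.tendsto _).comp (h (b i) (b j))
    simpa using (hc.sub_const (b.repr (β' (b i) (b j)) k)).pow 2
  simpa [pullbackDefect] using tendsto_finsetSum Finset.univ fun i _ =>
    tendsto_finsetSum Finset.univ fun j _ => tendsto_finsetSum Finset.univ fun k _ => hterm i j k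

/-- A contraction can be realized by a continuous family of invertible matrices. -/
lemma Contracts.exists_continuous_matrix [FiniteDimensional ℝ V] {μ μ' : LieBracketOn V}
    (h : Contracts μ μ') {d : ℕ} (b : Module.Basis (Fin d) ℝ V) :
    ∃ A : ℝ → Matrix (Fin d) (Fin d) ℝ, Continuous A ∧ (∀ s, (A s).det ≠ 0) ∧ ∀ i j,
      Tendsto (fun s => matrixPullback b μ.br (A s) (b i) (b j)) atTop
        (𝓝 (μ'.br (b i) (b j))) := by
  obtain ⟨Φ, hΦ⟩ := h
  choose G hG using fun k : ℕ =>
    exists_polynomial_pos_iff_pullbackDefect_lt b μ.br μ'.br (1 / ((k : ℝ) + 1))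
  let g : ℕ → Fin (d * d) → ℝ := fun m p =>
    LinearMap.toMatrix b b (Φ m) (finProdFinEquiv.symm p).1 (finProdFinEquiv.symm p).2
  have hg : ∀ m, matrixOfEntries (g m) = LinearMap.toMatrix b b (Φ m) := fun m => by
    ext i j
    simp only [matrixOfEntries, g, Matrix.of_apply, Equiv.symm_apply_apply]
  have hlim : Tendsto (fun m => pullbackDefect b μ.br μ'.br (matrixOfEntries (g m))) atTop
      (𝓝 0) := tendsto_pullbackDefect b fun X Y => by
    simp only [hg, matrixPullback_toMatrix]
    exact (hΦ X Y).comp tendsto_natCast_atTop_atTop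
  obtain ⟨Γ, hΓ, hpos⟩ := exists_continuous_curve_of_eventually_pos G
    (fun k x hx => by
      rw [hG] at hx ⊢
      exact ⟨hx.1, hx.2.trans (Nat.one_div_lt_one_div k.lt_succ_self)⟩) g
    fun k => by
      filter_upwards [hlim.eventually_lt_const (Nat.one_div_pos_of_nat (n := k))] with m hm
      rw [hG]
      refine ⟨?_, hm⟩
      rw [hg]
      exact ((Φ m).isUnit_det b b).ne_zero
  refine ⟨fun s => matrixOfEntries (Γ s), ?_, fun s => ((hG _ _).1 (hpos s)).1,
    tendsto_matrixPullback_of_pullbackDefect b ?_⟩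
  · exact continuous_matrix fun i j => (continuous_apply (finProdFinEquiv (i, j))).comp hΓ
  · refine squeeze_zero (fun s => ?_) (fun s => ((hG _ _).1 (hpos s)).2.le)
      (tendsto_one_div_add_atTop_nhds_zero_nat.comp tendsto_nat_floor_atTop)
    unfold pullbackDefect
    positivity

/-- The pullback of a Lie bracket along a linear automorphism. -/
def LieBracketOn.pullback (μ : LieBracketOn V) (e : V ≃ₗ[ℝ] V) : LieBracketOn V where
  br := (μ.br.compl₁₂ e.toLinearMap e.toLinearMap).compr₂ e.symm.toLinearMap
  alt x := by simp [μ.alt]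
  jacobi x y z := by simp [← map_add, μ.jacobi]

lemma LieBracketOn.pullback_br (μ : LieBracketOn V) (e : V ≃ₗ[ℝ] V) (X Y : V) :
    (μ.pullback e).br X Y = e.symm (μ.br (e X) (e Y)) := rfl

lemma LieBracketOn.brIso_pullback (μ : LieBracketOn V) (e : V ≃ₗ[ℝ] V) :
    BrIso (μ.pullback e) μ :=
  ⟨e, fun x y => by rw [pullback_br, e.apply_symm_apply]⟩

lemma BrIso.symm {μ μ' : LieBracketOn V} (h : BrIso μ μ') : BrIso μ' μ := by
  obtain ⟨e, he⟩ := h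
  exact ⟨e.symm, fun x y => by rw [e.symm_apply_eq, he, e.apply_symm_apply, e.apply_symm_apply]⟩

/-- For any contraction `g ⇝ g'` of finite-dimensional real Lie algebras with `g ≄ g'`,
there exists a plateau deformation from `g'` to `g` inverse to the contraction. -/
theorem contraction_admits_inverse_plateau_deformation [FiniteDimensional ℝ V]
    (μ μ' : LieBracketOn V) (h : Contracts μ μ') (hniso : ¬ BrIso μ μ') :
    ∃ μt : ℝ → LieBracketOn V, IsPlateauDeformation μ' μ μt := by
  classical
  let b := Module.finBasis ℝ V
  obtain ⟨A, hA, hdet, hlim⟩ := h.exists_continuous_matrix b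
  let e : ℝ → V ≃ₗ[ℝ] V := fun s => Matrix.toLinearEquiv b (A s) (hdet s).isUnit
  have he : ∀ s X Y, (μ.pullback (e s)).br X Y = matrixPullback b μ.br (A s) X Y :=
    fun _ _ _ => rfl
  let μt : ℝ → LieBracketOn V := fun t => if 0 < t then μ.pullback (e t⁻¹) else μ'
  have hμt : ∀ t, 0 < t → μt t = μ.pullback (e t⁻¹) := fun t ht => if_pos ht
  have hμ0 : μt 0 = μ' := if_neg (lt_irrefl 0)
  refine ⟨μt, fun X Y t ht => ?_, hμ0, fun t ht => ?_, fun hiso => hniso hiso.symm⟩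
  · rcases ht.1.eq_or_lt with rfl | hpos
    · have hIcc : Icc (0 : ℝ) 1 ⊆ insert 0 (Ioi 0) := fun t ht => by
        rcases ht.1.eq_or_lt with h | h
        · exact Or.inl h.symm
        · exact Or.inr h
      refine ContinuousWithinAt.mono (continuousWithinAt_insert_self.2 ?_) hIcc
      rw [ContinuousWithinAt, hμ0]
      refine (((tendsto_bilinear_of_basis b
        (B := fun s => (μ.pullback (e s)).br) hlim X Y).comp tendsto_inv_nhdsGT_zero)).congr' ?_
      filter_upwards [self_mem_nhdsWithin] with t ht
      simp only [Function.comp_apply, hμt t ht]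
    · have hcont : ContinuousAt (fun t : ℝ => matrixPullback b μ.br (A t⁻¹) X Y) t :=
        ContinuousAt.comp (f := fun t : ℝ => A t⁻¹)
          (continuousAt_matrixPullback b μ.br (hdet t⁻¹) X Y)
          (hA.continuousAt.comp (continuousAt_inv₀ hpos.ne'))
      refine (hcont.congr ?_).continuousWithinAt
      filter_upwards [Ioi_mem_nhds hpos] with s hs
      rw [hμt s hs, he]
  · rw [hμt t ht.1]
    exact μ.brIso_pullback _
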